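/- Consider the IMA method with the step size IMA-SPS_safe and the momentum sequence λ_t = t. Then the last iterate satisfies E[f(x^{T−1}) − f(x*)] + (1/T)·Σ_{t=0}^{T−1} t·E[B_f(x^{t−1}, x^t)] ≤ (√(max{G², M})·‖x^0 − x*‖)/√T + √(max{G², M}/M)·σ². -/

import Mathlib

open RealInnerProductSpace

/-- One step of a truncated Polyak step size with denominator `D ≥ ‖v‖²`. -/
lemma sq_dist_polyak_step_le {E : Type*} [NormedAddCommGroup E] [InnerProductSpace ℝ E]
    (z v y : E) {p s D : ℝ} (hD : 0 < D) (hv : ‖v‖ ^ 2 ≤ D) (hp : p - s ≤ ⟪v, z - y⟫) :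
    (max p 0 - s) ^ 2 / D ≤
      ‖z - y‖ ^ 2 - ‖z - (max p 0 / D) • v - y‖ ^ 2 + s ^ 2 / D := by
  set q := max p 0 with hq
  have hq0 : 0 ≤ q := le_max_right _ _
  have hqp : q * p = q ^ 2 := by
    rcases max_choice p 0 with h | h <;> rw [← hq] at h <;> rw [h] <;> ring
  have hexp : ‖z - (q / D) • v - y‖ ^ 2 =
      ‖z - y‖ ^ 2 - 2 * ((q / D) * ⟪v, z - y⟫) + (q / D) ^ 2 * ‖v‖ ^ 2 := by
    rw [show z - (q / D) • v - y = (z - y) - (q / D) • v by abel, norm_sub_sq_real,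
      inner_smul_right, real_inner_comm, norm_smul, mul_pow, Real.norm_eq_abs, sq_abs]
  have h1 : (q / D) * (p - s) ≤ (q / D) * ⟪v, z - y⟫ :=
    mul_le_mul_of_nonneg_left hp (by positivity)
  have h2 : (q / D) ^ 2 * ‖v‖ ^ 2 ≤ (q / D) ^ 2 * D :=
    mul_le_mul_of_nonneg_left hv (by positivity)
  have h3 : (q / D) ^ 2 * D = q ^ 2 / D := by field_simp
  have h4 : (q / D) * (p - s) = q ^ 2 / D - q * s / D := by
    rw [← hqp]; ring
  have h5 : (q - s) ^ 2 / D = q ^ 2 / D - 2 * (q * s / D) + s ^ 2 / D := by ring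
  rw [hexp, h5]
  linarith

/-- If `φ i ω` does not depend on the coordinate `ω k`, then averaging over `ω` allows the
sampled index `ω k` to be replaced by an independent uniform index. -/
lemma card_mul_sum_apply_eq_sum_sum {ι κ : Type*} [Fintype ι] [DecidableEq ι] [Fintype κ]
    (k : ι) (φ : κ → (ι → κ) → ℝ)
    (hφ : ∀ i ω j, φ i (Function.update ω k j) = φ i ω) :
    (Fintype.card κ : ℝ) * ∑ ω : ι → κ, φ (ω k) ω = ∑ ω : ι → κ, ∑ i, φ i ω := by
  have hinv : Function.Involutive
      (fun q : (ι → κ) × κ => (Function.update q.1 k q.2, q.1 k)) := by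
    rintro ⟨ω, i⟩
    simp
  rw [← Fintype.sum_prod_type' (f := fun ω i => φ i ω), ← Equiv.sum_comp hinv.toPerm,
    Fintype.sum_prod_type, Finset.mul_sum]
  simp [hφ]

lemma sum_range_succ_mul_sub_mul_pred (a : ℕ → ℝ) (m : ℕ) :
    ∑ t ∈ Finset.range m, ((t + 1 : ℝ) * a t - t * a (t - 1)) = m * a (m - 1) := by
  induction m with
  | zero => simp
  | succ m ih =>
    rw [Finset.sum_range_succ, ih]
    simp

/-- Last-iterate convergence of the IMA method with the safeguarded Polyak-type
step size `IMA-SPS_safe` and momentum sequence `λ_t = t` (Theorem 3.5):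
`E[f(x^{T−1}) − f(x*)] + (1/T)·Σ_{t<T} t·E[B_f(x^{t−1}, x^t)]
  ≤ √(max{G², M})·‖x⁰ − x*‖/√T + √(max{G², M}/M)·σ²`,
where `x^{−1} = x⁰` (encoded via natural subtraction `t − 1`),
`B_f(u, v) = f(u) − f(v) − ⟨ḡ(v), u − v⟩` with `ḡ(v) = (1/n)·Σ_i g_i(v)`,
and `σ² = ((1/n)·Σ_i (f_i(x*) − ℓ_i)²)^{1/2}`. -/
theorem ima_sps_safe_last_iterate (d n T : ℕ) (hd : 1 ≤ d) (hn : 1 ≤ n)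
    (hT : 1 ≤ T)
    (f : Fin n → EuclideanSpace ℝ (Fin d) → ℝ)
    (g : Fin n → EuclideanSpace ℝ (Fin d) → EuclideanSpace ℝ (Fin d))
    (G M : ℝ) (ℓ : Fin n → ℝ)
    (hconv : ∀ i x y, f i x + ⟪g i x, y - x⟫ ≤ f i y)
    (hG : ∀ i x, ‖g i x‖ ≤ G)
    (hl : ∀ i x, ℓ i ≤ f i x)
    (F : EuclideanSpace ℝ (Fin d) → ℝ)
    (hF : ∀ x, F x = (n : ℝ)⁻¹ * ∑ i, f i x)
    (gbar : EuclideanSpace ℝ (Fin d) → EuclideanSpace ℝ (Fin d))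
    (hgbar : ∀ v, gbar v = (n : ℝ)⁻¹ • ∑ i, g i v)
    (xstar : EuclideanSpace ℝ (Fin d))
    (hmin : ∀ x, F xstar ≤ F x)
    (σ2 : ℝ) (hσ2 : σ2 = Real.sqrt ((n : ℝ)⁻¹ * ∑ i, (f i xstar - ℓ i) ^ 2))
    (hM : 0 < M)
    (x0 : EuclideanSpace ℝ (Fin d))
    (x z : (Fin T → Fin n) → ℕ → EuclideanSpace ℝ (Fin d))
    (hx0 : ∀ ω, x ω 0 = x0) (hz0 : ∀ ω, z ω 0 = x0)
    (hzstep : ∀ ω, ∀ t : ℕ, ∀ ht : t < T,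
      z ω (t + 1) = z ω t -
        ((max (f (ω ⟨t, ht⟩) (x ω t) - ℓ (ω ⟨t, ht⟩) +
              (t : ℝ) * ⟪g (ω ⟨t, ht⟩) (x ω t), x ω t - x ω (t - 1)⟫) 0 /
            max (‖g (ω ⟨t, ht⟩) (x ω t)‖ ^ 2) M) • g (ω ⟨t, ht⟩) (x ω t)))
    (hxstep : ∀ ω, ∀ t : ℕ, t < T →
      x ω (t + 1) = ((t + 1 : ℝ) + 1)⁻¹ • ((t + 1 : ℝ) • x ω t + z ω (t + 1))) :
    ((n : ℝ) ^ T)⁻¹ * ∑ ω : Fin T → Fin n, (F (x ω (T - 1)) - F xstar) +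
      (T : ℝ)⁻¹ * ∑ t ∈ Finset.range T, (t : ℝ) *
        (((n : ℝ) ^ T)⁻¹ * ∑ ω : Fin T → Fin n,
          (F (x ω (t - 1)) - F (x ω t) -
            ⟪gbar (x ω t), x ω (t - 1) - x ω t⟫)) ≤
      Real.sqrt (max (G ^ 2) M) * ‖x0 - xstar‖ / Real.sqrt T +
        Real.sqrt (max (G ^ 2) M / M) * σ2 := by
  have hnpos : (0 : ℝ) < n := by exact_mod_cast hn
  have hTpos : (0 : ℝ) < T := by exact_mod_cast hT
  have hnT : (0 : ℝ) < (n : ℝ) ^ T := by positivity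
  have hadapt : ∀ (ω ω' : Fin T → Fin n) (t : ℕ),
      (∀ k : Fin T, (k : ℕ) < t → ω k = ω' k) → ∀ s ≤ t, s ≤ T → ∀ r ≤ s,
        x ω r = x ω' r ∧ z ω r = z ω' r := by
    intro ω ω' t hω s
    induction s with
    | zero =>
      intro _ _ r hr
      obtain rfl : r = 0 := by omega
      simp [hx0, hz0]
    | succ s ih =>
      intro hs hsT r hr
      have ih := ih (by omega) (by omega)
      rcases Nat.lt_or_ge r (s + 1) with h | h
      · exact ih r (by omega)
      · obtain rfl : r = s + 1 := by omega
        have hz : z ω (s + 1) = z ω' (s + 1) := by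
          rw [hzstep ω s (by omega), hzstep ω' s (by omega), (ih s le_rfl).1, (ih s le_rfl).2,
            (ih (s - 1) (by omega)).1, hω ⟨s, by omega⟩ (by simp; omega)]
        exact ⟨by rw [hxstep ω s (by omega), hxstep ω' s (by omega), (ih s le_rfl).1, hz], hz⟩
  have hupd : ∀ (ω : Fin T → Fin n) (k : Fin T) (j : Fin n) (r : ℕ), r ≤ k →
      x (Function.update ω k j) r = x ω r := by
    intro ω k j r hr
    refine (hadapt _ ω k (fun i hi => ?_) k le_rfl k.2.le r hr).1
    rw [Function.update_of_ne]
    rintro rfl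
    exact lt_irrefl _ hi
  have hzx : ∀ ω, ∀ t < T, z ω t = x ω t + (t : ℝ) • (x ω t - x ω (t - 1)) := by
    intro ω t ht
    cases t with
    | zero => simp [hx0, hz0]
    | succ t =>
      have hpos : ((t + 1 : ℝ) + 1) ≠ 0 := by positivity
      have h := congrArg (fun v => ((t + 1 : ℝ) + 1) • v) (hxstep ω t (by omega))
      simp only [smul_inv_smul₀ hpos] at h
      rw [Nat.add_sub_cancel, eq_sub_of_add_eq' h.symm]
      push_cast
      module
  set Q := max (G ^ 2) M with hQ
  have hQpos : 0 < Q := lt_max_of_lt_right hM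
  set p : (Fin T → Fin n) → Fin T → Fin n → ℝ := fun ω t i =>
    f i (x ω t) - ℓ i + (t : ℝ) * ⟪g i (x ω t), x ω t - x ω (t - 1)⟫ with hp
  set s : Fin n → ℝ := fun i => f i xstar - ℓ i with hs
  set R := ‖x0 - xstar‖ with hR
  -- energy estimate along each trajectory
  have hpath : ∀ ω, ∑ t : Fin T, (max (p ω t (ω t)) 0 - s (ω t)) ^ 2 ≤
      Q * (R ^ 2 + (∑ t : Fin T, s (ω t) ^ 2) / M) := by
    intro ω
    have hstep : ∀ t : Fin T, (max (p ω t (ω t)) 0 - s (ω t)) ^ 2 / Q ≤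
        ‖z ω t - xstar‖ ^ 2 - ‖z ω (t + 1) - xstar‖ ^ 2 + s (ω t) ^ 2 / M := by
      intro t
      set v := g (ω t) (x ω t) with hv
      have hMD : M ≤ max (‖v‖ ^ 2) M := le_max_right _ _
      have hDQ : max (‖v‖ ^ 2) M ≤ Q :=
        max_le_max_right _ (pow_le_pow_left₀ (norm_nonneg _) (hG _ _) 2)
      have hDpos := hM.trans_le hMD
      have hsub : p ω t (ω t) - s (ω t) ≤ ⟪v, z ω t - xstar⟫ := by
        have hc := hconv (ω t) (x ω t) xstar
        rw [← neg_sub (x ω t) xstar, inner_neg_right] at hc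
        rw [hzx ω t t.2, add_sub_right_comm (x ω t), inner_add_right, inner_smul_right]
        simp only [hp, hs]
        linarith
      have h := sq_dist_polyak_step_le (z ω t) v xstar hDpos (le_max_left _ _) hsub
      have hz' : z ω (t + 1) = z ω t - (max (p ω t (ω t)) 0 / max (‖v‖ ^ 2) M) • v :=
        hzstep ω t t.2
      rw [← hz'] at h
      have h1 : (max (p ω t (ω t)) 0 - s (ω t)) ^ 2 / Q ≤
          (max (p ω t (ω t)) 0 - s (ω t)) ^ 2 / max (‖v‖ ^ 2) M := by gcongr
      have h2 : s (ω t) ^ 2 / max (‖v‖ ^ 2) M ≤ s (ω t) ^ 2 / M := by gcongr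
      linarith
    have hsum := Finset.sum_le_sum fun t (_ : t ∈ Finset.univ) => hstep t
    rw [Finset.sum_add_distrib, ← Finset.sum_div, ← Finset.sum_div,
      ← Finset.sum_range fun t => ‖z ω t - xstar‖ ^ 2 - ‖z ω (t + 1) - xstar‖ ^ 2,
      Finset.sum_range_sub' fun t => ‖z ω t - xstar‖ ^ 2, hz0, div_le_iff₀' hQpos] at hsum
    refine hsum.trans (mul_le_mul_of_nonneg_left ?_ hQpos.le)
    have := sq_nonneg ‖z ω T - xstar‖
    linarith
  have hσ0 : 0 ≤ σ2 := hσ2 ▸ Real.sqrt_nonneg _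
  have hσsq : ∑ i, s i ^ 2 = n * σ2 ^ 2 := by
    rw [hσ2, Real.sq_sqrt (by positivity), mul_inv_cancel_left₀ hnpos.ne']
  have hnoise : ∑ ω : Fin T → Fin n, ∑ t : Fin T, s (ω t) ^ 2 = (n : ℝ) ^ T * (T * σ2 ^ 2) := by
    rw [Finset.sum_comm]
    have h : ∀ t : Fin T, ∑ ω : Fin T → Fin n, s (ω t) ^ 2 = (n : ℝ) ^ T * σ2 ^ 2 := by
      intro t
      have h := card_mul_sum_apply_eq_sum_sum t (fun i (_ : Fin T → Fin n) => s i ^ 2)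
        (fun _ _ _ => rfl)
      simp only [hσsq, Fintype.card_fin, Finset.sum_const, Finset.card_univ, Fintype.card_fun,
        nsmul_eq_mul, Nat.cast_pow] at h
      apply mul_left_cancel₀ hnpos.ne'
      rw [h]
      ring
    simp only [h, Finset.sum_const, Finset.card_univ, Fintype.card_fin, nsmul_eq_mul]
    ring
  have henergy : ∑ ω : Fin T → Fin n, ∑ t : Fin T, (max (p ω t (ω t)) 0 - s (ω t)) ^ 2 ≤
      (n : ℝ) ^ T * (Q * (R ^ 2 + T * σ2 ^ 2 / M)) := by
    refine (Finset.sum_le_sum fun ω _ => hpath ω).trans_eq ?_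
    rw [← Finset.mul_sum, Finset.sum_add_distrib, ← Finset.sum_div, hnoise]
    simp only [Finset.sum_const, Finset.card_univ, Fintype.card_fun, Fintype.card_fin,
      nsmul_eq_mul, Nat.cast_pow]
    ring
  set S := ∑ ω : Fin T → Fin n, ∑ t : Fin T, (max (p ω t (ω t)) 0 - s (ω t)) with hS
  have hcs : S ^ 2 ≤ ((n : ℝ) ^ T * T) *
      ∑ ω : Fin T → Fin n, ∑ t : Fin T, (max (p ω t (ω t)) 0 - s (ω t)) ^ 2 := by
    have h := sq_sum_le_card_mul_sum_sq
      (s := (Finset.univ : Finset ((Fin T → Fin n) × Fin T)))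
      (f := fun q => max (p q.1 q.2 (q.1 q.2)) 0 - s (q.1 q.2))
    rw [Fintype.sum_prod_type, Fintype.sum_prod_type] at h
    simpa only [Finset.card_univ, Fintype.card_prod, Fintype.card_fun, Fintype.card_fin,
      Nat.cast_mul, Nat.cast_pow] using h
  -- the left-hand side is the average of `p - s`
  have hmean : ∀ t : Fin T, ∑ ω : Fin T → Fin n, (p ω t (ω t) - s (ω t)) =
      ∑ ω : Fin T → Fin n, (F (x ω t) - F xstar +
        (t : ℝ) * ⟪gbar (x ω t), x ω t - x ω (t - 1)⟫) := by
    intro t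
    have h := card_mul_sum_apply_eq_sum_sum t (fun i ω => p ω t i - s i) (by
      intro i ω j
      simp only [hp, hupd ω t j t le_rfl, hupd ω t j (t - 1) (Nat.sub_le _ _)])
    rw [Fintype.card_fin] at h
    apply mul_left_cancel₀ hnpos.ne'
    rw [h, Finset.mul_sum]
    refine Finset.sum_congr rfl fun ω _ => ?_
    simp only [hp, hs, hF, hgbar, inner_smul_left, sum_inner, Finset.sum_sub_distrib,
      Finset.sum_add_distrib, ← Finset.mul_sum, map_inv₀, map_natCast]
    field_simp
    ring
  have hlhs : ((n : ℝ) ^ T)⁻¹ * ∑ ω : Fin T → Fin n, (F (x ω (T - 1)) - F xstar) +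
      (T : ℝ)⁻¹ * ∑ t ∈ Finset.range T, (t : ℝ) *
        (((n : ℝ) ^ T)⁻¹ * ∑ ω : Fin T → Fin n,
          (F (x ω (t - 1)) - F (x ω t) - ⟪gbar (x ω t), x ω (t - 1) - x ω t⟫)) =
      ((n : ℝ) ^ T * T)⁻¹ *
        ∑ ω : Fin T → Fin n, ∑ t : Fin T, (p ω t (ω t) - s (ω t)) := by
    have h : ∀ ω : Fin T → Fin n, (T : ℝ) * (F (x ω (T - 1)) - F xstar) +
        ∑ t ∈ Finset.range T, (t : ℝ) *
          (F (x ω (t - 1)) - F (x ω t) - ⟪gbar (x ω t), x ω (t - 1) - x ω t⟫) =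
        ∑ t ∈ Finset.range T, (F (x ω t) - F xstar +
          (t : ℝ) * ⟪gbar (x ω t), x ω t - x ω (t - 1)⟫) := by
      intro ω
      rw [← sum_range_succ_mul_sub_mul_pred (fun t => F (x ω t) - F xstar),
        ← Finset.sum_add_distrib]
      refine Finset.sum_congr rfl fun t _ => ?_
      rw [← neg_sub (x ω t) (x ω (t - 1)), inner_neg_right]
      ring
    rw [Finset.sum_comm, Finset.sum_congr rfl fun t _ => hmean t, Finset.sum_comm]
    simp only [Finset.sum_range] at h
    rw [← Finset.sum_congr rfl fun ω _ => h ω, Finset.sum_add_distrib, ← Finset.mul_sum,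
      Finset.sum_comm (s := (Finset.univ : Finset (Fin T → Fin n))), Finset.sum_range]
    simp only [← Finset.mul_sum, mul_left_comm _ ((n : ℝ) ^ T)⁻¹]
    field_simp
  rw [hlhs]
  have hle : ∑ ω : Fin T → Fin n, ∑ t : Fin T, (p ω t (ω t) - s (ω t)) ≤ S :=
    Finset.sum_le_sum fun ω _ => Finset.sum_le_sum fun t _ =>
      sub_le_sub_right (le_max_left _ _) _
  rw [inv_mul_le_iff₀ (by positivity)]
  refine hle.trans (abs_le_of_sq_le_sq' ?_ (by positivity)).2
  refine hcs.trans ((mul_le_mul_of_nonneg_left henergy (by positivity)).trans ?_)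
  have hcross : 0 ≤ 2 * (√Q * R / √T) * (√(Q / M) * σ2) := by positivity
  have hsq : (√Q * R / √T + √(Q / M) * σ2) ^ 2 =
      Q * R ^ 2 / T + 2 * (√Q * R / √T) * (√(Q / M) * σ2) + Q / M * σ2 ^ 2 := by
    rw [add_sq, div_pow, mul_pow, mul_pow, Real.sq_sqrt hQpos.le, Real.sq_sqrt hTpos.le,
      Real.sq_sqrt (by positivity)]
  calc (n : ℝ) ^ T * T * ((n : ℝ) ^ T * (Q * (R ^ 2 + T * σ2 ^ 2 / M)))
      = ((n : ℝ) ^ T * T) ^ 2 * (Q * R ^ 2 / T + Q / M * σ2 ^ 2) := by field_simp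
    _ ≤ ((n : ℝ) ^ T * T) ^ 2 * (√Q * R / √T + √(Q / M) * σ2) ^ 2 := by
        refine mul_le_mul_of_nonneg_left ?_ (by positivity)
        rw [hsq]
        linarith
    _ = ((n : ℝ) ^ T * T * (√Q * R / √T + √(Q / M) * σ2)) ^ 2 := (mul_pow _ _ _).symm
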